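/- arXiv:math/0212303 — 4 statements merged into one kernel-verified Lean document; each statement's English description precedes it below -/
import Mathlib

section
/- (One-variable core of Proposition 3.6, contour shift.) Let r₁ < r₁₂ < r₂ be real numbers and let f be a meromorphic function on an open neighborhood of the closed vertical strip {z ∈ ℂ : r₁ ≤ Re z ≤ r₂} satisfying f(z + iT) = f(z) for all z in the strip. Assume f is holomorphic at every point of the two lines Re z = r₁ and Re z = r₂, and that every pole of f with r₁ ≤ Re ≤ r₂ has real part exactly r₁₂. Then the set P of poles p of f with Re p = r₁₂ and 0 ≤ Im p < T is finite, and ∫₀^T f(r₂ + it) dt − ∫₀^T f(r₁ + it) dt = 2π · Σ_{p∈P} Res_p f. -/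
open MeasureTheory

/-- A point `p` is a pole of `f` if `‖f z‖ → ∞` as `z → p`, `z ≠ p`. -/
def IsPole (f : ℂ → ℂ) (p : ℂ) : Prop :=
  Filter.Tendsto (fun z => ‖f z‖) (nhdsWithin p {p}ᶜ) Filter.atTop

open Complex Filter Topology Set Metric

/-- `r` is the residue of `f` at `p`, computed on all small circles around `p`. -/
def HasResidue (f : ℂ → ℂ) (p r : ℂ) : Prop :=
  ∀ᶠ ε : ℝ in 𝓝[>] 0, CircleIntegrable f p ε ∧ (∮ z in C(p, ε), f z) = 2 * Real.pi * I * r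

theorem eventually_sphere_of_eventually_nhdsNE {P : ℂ → Prop} {p : ℂ}
    (h : ∀ᶠ z in 𝓝[≠] p, P z) : ∀ᶠ ε : ℝ in 𝓝[>] 0, ∀ z ∈ sphere p ε, P z := by
  rw [eventually_nhdsWithin_iff, Metric.eventually_nhds_iff] at h
  obtain ⟨δ, hδ, h⟩ := h
  filter_upwards [Ioo_mem_nhdsGT hδ] with ε hε z hz
  refine h ((mem_sphere.1 hz).trans_lt hε.2) ?_
  rintro rfl
  simp [hε.1.ne] at hz

namespace HasResidue

variable {f g : ℂ → ℂ} {p r s : ℂ}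

theorem add (hf : HasResidue f p r) (hg : HasResidue g p s) :
    HasResidue (fun z => f z + g z) p (r + s) := by
  filter_upwards [hf, hg] with ε hf hg
  refine ⟨hf.1.add hg.1, ?_⟩
  rw [circleIntegral.integral_add hf.1 hg.1, hf.2, hg.2]
  ring

theorem const_mul (c : ℂ) (hf : HasResidue f p r) :
    HasResidue (fun z => c * f z) p (c * r) := by
  filter_upwards [hf] with ε hf
  refine ⟨hf.1.const_smul (a := c), ?_⟩
  rw [circleIntegral.integral_const_mul, hf.2]
  ring

/-- Cauchy's formula: `(z - p)⁻¹ * h z` has residue `h p` at `p`. -/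
theorem of_eventuallyEq {h : ℂ → ℂ} (hh : AnalyticAt ℂ h p)
    (hf : ∀ᶠ z in 𝓝[≠] p, f z = (z - p)⁻¹ * h z) : HasResidue f p (h p) := by
  have hd : ∀ᶠ ε : ℝ in 𝓝[>] 0, DifferentiableOn ℂ h (closedBall p ε) := by
    obtain ⟨δ, hδ, hd⟩ := Metric.eventually_nhds_iff.1 hh.eventually_analyticAt
    filter_upwards [Ioo_mem_nhdsGT hδ] with ε hε z hz
    exact (hd ((mem_closedBall.1 hz).trans_lt hε.2)).differentiableAt.differentiableWithinAt
  filter_upwards [hd, eventually_sphere_of_eventually_nhdsNE hf, self_mem_nhdsWithin]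
    with ε hd hf (hε : 0 < ε)
  have hne : ∀ z ∈ sphere p ε, z - p ≠ 0 := by
    intro z hz h0
    rw [sub_eq_zero.1 h0] at hz
    simp [hε.ne] at hz
  constructor
  · refine ContinuousOn.circleIntegrable hε.le (ContinuousOn.congr ?_ hf)
    refine ContinuousOn.mul (ContinuousOn.inv₀ (by fun_prop) hne) ?_
    exact hd.continuousOn.mono sphere_subset_closedBall
  · rw [circleIntegral.integral_congr hε.le hf]
    simpa using hd.circleIntegral_sub_inv_smul (mem_ball_self hε)

theorem of_meromorphicOrderAt_nonneg (hf : MeromorphicAt f p)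
    (h : 0 ≤ meromorphicOrderAt f p) : HasResidue f p 0 := by
  have hg := hf.meromorphicOrderAt_nonneg_iff_analyticAt_toMeromorphicNFAt.1 h
  have := of_eventuallyEq (f := f) (h := fun z => (z - p) * toMeromorphicNFAt f p z)
    (AnalyticAt.mul (by fun_prop) hg) ?_
  · simpa using this
  · filter_upwards [hf.eq_nhdsNE_toMeromorphicNFAt, self_mem_nhdsWithin] with z hz hne
    rw [hz, inv_mul_cancel_left₀ (sub_ne_zero.2 hne)]

end HasResidue

/-- The function `exp (L z) / (exp (L z) - exp (L p)) ^ k`, which is periodic with period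
`2πi / L` and has a pole of order `k` at `p`. -/
noncomputable def expPole (L : ℝ) (p : ℂ) (k : ℕ) (z : ℂ) : ℂ :=
  exp (L * z) * ((exp (L * z) - exp (L * p)) ^ k)⁻¹

section expPole

variable {L T : ℝ} {p z : ℂ} {k : ℕ}

theorem meromorphicAt_expPole : MeromorphicAt (expPole L p k) z := by
  have h : AnalyticAt ℂ (fun z => exp (L * z)) z := by fun_prop
  exact h.meromorphicAt.mul (((h.sub analyticAt_const).pow k).meromorphicAt.inv)

theorem analyticAt_expPole (h : exp (L * z) ≠ exp (L * p)) :
    AnalyticAt ℂ (expPole L p k) z := by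
  unfold expPole
  exact AnalyticAt.mul (by fun_prop)
    (AnalyticAt.inv (by fun_prop) (pow_ne_zero _ (sub_ne_zero.2 h)))

theorem expPole_add_period (hLT : L * T = 2 * Real.pi) :
    expPole L p k (z + I * T) = expPole L p k z := by
  have : exp (L * (z + I * T)) = exp (L * z) := by
    rw [← exp_periodic (L * z)]
    congr 1
    have : (L * T : ℂ) = 2 * Real.pi := by exact_mod_cast hLT
    linear_combination I * this
  simp only [expPole, this]

theorem exists_eq_mul_of_exp_sub (L : ℝ) (p : ℂ) :
    ∃ h : ℂ → ℂ, AnalyticAt ℂ h p ∧ h p = L * exp (L * p) ∧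
      ∀ z, exp (L * z) - exp (L * p) = (z - p) * h z := by
  have hd : HasDerivAt (fun z : ℂ => exp (L * z)) (L * exp (L * p)) p := by
    simpa [mul_comm] using ((hasDerivAt_id p).const_mul (L : ℂ)).cexp
  refine ⟨dslope (fun z => exp (L * z)) p, ?_, ?_, fun z => ?_⟩
  · have : DifferentiableOn ℂ (fun z : ℂ => exp (L * z)) univ := by fun_prop
    exact ((Complex.differentiableOn_dslope univ_mem).2 this).analyticAt univ_mem
  · rw [dslope_same, hd.deriv]
  · rw [← smul_eq_mul (z - p), sub_smul_dslope]

theorem meromorphicOrderAt_expPole (hL : 0 < L) :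
    meromorphicOrderAt (expPole L p k) p = ((-k : ℤ) : WithTop ℤ) := by
  obtain ⟨h, hh, hp, heq⟩ := exists_eq_mul_of_exp_sub L p
  have hp0 : h p ≠ 0 := by
    rw [hp]; exact mul_ne_zero (by exact_mod_cast hL.ne') (exp_ne_zero _)
  rw [meromorphicOrderAt_eq_int_iff meromorphicAt_expPole]
  refine ⟨fun z => exp (L * z) * (h z ^ k)⁻¹, ?_, by simp [hp0], .of_forall fun z => ?_⟩
  · exact AnalyticAt.mul (by fun_prop) ((hh.pow k).inv (pow_ne_zero _ hp0))
  · simp only [expPole, heq, smul_eq_mul, mul_pow, mul_inv, zpow_neg, zpow_natCast]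
    ring

theorem hasResidue_expPole_one (hL : 0 < L) : HasResidue (expPole L p 1) p (L : ℂ)⁻¹ := by
  obtain ⟨h, hh, hp, heq⟩ := exists_eq_mul_of_exp_sub L p
  have hL' : (L : ℂ) ≠ 0 := by exact_mod_cast hL.ne'
  have hp0 : h p ≠ 0 := by rw [hp]; exact mul_ne_zero hL' (exp_ne_zero _)
  have := HasResidue.of_eventuallyEq (f := expPole L p 1) (h := fun z => exp (L * z) * (h z)⁻¹)
    (AnalyticAt.mul (by fun_prop) (hh.inv hp0)) (.of_forall fun z => by
      simp only [expPole, heq, pow_one, mul_inv]; ring)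
  convert this using 1
  rw [hp]
  field_simp

theorem hasResidue_expPole_of_two_le (hL : 0 < L) :
    HasResidue (expPole L p (k + 2)) p 0 := by
  have hL' : (L : ℂ) ≠ 0 := by exact_mod_cast hL.ne'
  have hd (z : ℂ) : HasDerivAt (fun z : ℂ => exp (L * z)) (L * exp (L * z)) z := by
    simpa [mul_comm] using ((hasDerivAt_id z).const_mul (L : ℂ)).cexp
  have hne := (hd p).eventually_ne (c := exp (L * p)) (mul_ne_zero hL' (exp_ne_zero _))
  filter_upwards [eventually_sphere_of_eventually_nhdsNE hne, self_mem_nhdsWithin]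
    with ε hne (hε : 0 < ε)
  constructor
  · refine ContinuousOn.circleIntegrable hε.le fun z hz => ?_
    exact (analyticAt_expPole (hne z hz)).continuousAt.continuousWithinAt
  · rw [mul_zero]
    refine circleIntegral.integral_eq_zero_of_hasDerivWithinAt
      (f := fun z => -((L : ℂ) * (k + 1))⁻¹ * ((exp (L * z) - exp (L * p)) ^ (k + 1))⁻¹) hε.le
      fun z hz => HasDerivAt.hasDerivWithinAt ?_
    have h0 := sub_ne_zero.2 (hne z hz)
    have hk : (k + 1 : ℂ) ≠ 0 := by exact_mod_cast k.succ_ne_zero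
    refine HasDerivAt.congr_deriv (((((hd z).sub_const (exp (L * p))).pow (k + 1)).inv
      (pow_ne_zero _ h0)).const_mul (-((L : ℂ) * (k + 1))⁻¹)) ?_
    simp only [expPole, Nat.add_sub_cancel, Pi.pow_apply]
    push_cast
    field_simp
    ring

theorem integral_expPole_eq_circleIntegral (hL : 0 < L) (hLT : L * T = 2 * Real.pi) (x : ℝ) :
    ∫ t in (0 : ℝ)..T, expPole L p k (x + t * I) =
      (L * I : ℂ)⁻¹ * ∮ w in C(0, Real.exp (L * x)), ((w - exp (L * p)) ^ k)⁻¹ := by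
  have hL' : (L : ℂ) ≠ 0 := by exact_mod_cast hL.ne'
  have key (t : ℝ) : expPole L p k (x + t * I) =
      I⁻¹ * (fun θ : ℝ => deriv (circleMap 0 (Real.exp (L * x))) θ •
        ((circleMap 0 (Real.exp (L * x)) θ - exp (L * p)) ^ k)⁻¹) (L * t) := by
    have : exp (L * (x + t * I)) = circleMap 0 (Real.exp (L * x)) (L * t) := by
      simp only [circleMap, zero_add, ofReal_exp, ← exp_add]
      push_cast; ring_nf
    simp only [expPole, this, deriv_circleMap, smul_eq_mul]
    field_simp
  simp only [key]
  rw [intervalIntegral.integral_const_mul,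
    intervalIntegral.integral_comp_mul_left (fun θ : ℝ => deriv (circleMap 0 (Real.exp (L * x))) θ •
      ((circleMap 0 (Real.exp (L * x)) θ - exp (L * p)) ^ k)⁻¹) hL.ne',
    circleIntegral, hLT, mul_zero]
  simp only [real_smul, ofReal_inv, mul_inv]
  ring

theorem integral_expPole_of_two_le (hL : 0 < L) (hLT : L * T = 2 * Real.pi) (x : ℝ) :
    ∫ t in (0 : ℝ)..T, expPole L p (k + 2) (x + t * I) = 0 := by
  have := circleIntegral.integral_sub_zpow_of_ne (n := -(k + 2 : ℕ)) (by omega) 0 (exp (L * p))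
    (Real.exp (L * x))
  simp only [zpow_neg, zpow_natCast] at this
  rw [integral_expPole_eq_circleIntegral hL hLT, this, mul_zero]

theorem integral_expPole_one_of_re_lt (hL : 0 < L) (hLT : L * T = 2 * Real.pi) {x : ℝ}
    (hx : p.re < x) :
    ∫ t in (0 : ℝ)..T, expPole L p 1 (x + t * I) = 2 * Real.pi * (L : ℂ)⁻¹ := by
  have hp : exp (L * p) ∈ ball (0 : ℂ) (Real.exp (L * x)) := by
    simp [norm_exp, hL, hx]
  rw [integral_expPole_eq_circleIntegral hL hLT]
  simp only [pow_one, circleIntegral.integral_sub_inv_of_mem_ball hp]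
  field_simp

theorem integral_expPole_one_of_lt_re (hL : 0 < L) (hLT : L * T = 2 * Real.pi) {x : ℝ}
    (hx : x < p.re) :
    ∫ t in (0 : ℝ)..T, expPole L p 1 (x + t * I) = 0 := by
  rw [integral_expPole_eq_circleIntegral hL hLT]
  have hne : ∀ z ∈ closedBall (0 : ℂ) (Real.exp (L * x)), z - exp (L * p) ≠ 0 := by
    intro z hz h0
    rw [sub_eq_zero.1 h0, mem_closedBall_zero_iff, norm_exp, Real.exp_le_exp] at hz
    simp at hz
    nlinarith
  have hd : DifferentiableOn ℂ (fun z => ((z - exp (L * p)) ^ 1)⁻¹)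
      (closedBall (0 : ℂ) (Real.exp (L * x))) := by
    simp only [pow_one]
    exact DifferentiableOn.inv (by fun_prop) hne
  rw [(hd.mono closure_ball_subset_closedBall).diffContOnCl.circleIntegral_eq_zero
    (Real.exp_pos _).le, mul_zero]

theorem eq_of_exp_eq (hL : 0 < L) (hLT : L * T = 2 * Real.pi) (h0 : 0 ≤ z.im) (hT : z.im < T)
    (hp0 : 0 ≤ p.im) (hpT : p.im < T) (h : exp (L * z) = exp (L * p)) : z = p := by
  obtain ⟨n, hn⟩ := exp_eq_exp_iff_exists_int.1 h
  have hL' : (L : ℂ) ≠ 0 := by exact_mod_cast hL.ne'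
  have hLT' : (L * T : ℂ) = 2 * Real.pi := by exact_mod_cast hLT
  have hz : z = p + n * T * I := by
    apply mul_left_cancel₀ hL'
    linear_combination hn - n * I * hLT'
  have him : z.im = p.im + n * T := by simp [hz]
  have hTpos : 0 < T := h0.trans_lt hT
  have h1 : (n : ℝ) < 1 := by nlinarith
  have h2 : (-1 : ℝ) < n := by nlinarith
  have : n = 0 := by
    have h1' : n < 1 := by exact_mod_cast h1
    have h2' : -1 < n := by exact_mod_cast h2
    omega
  simp [hz, this]

theorem exp_ne_exp_of_re_ne (hL : 0 < L) (h : z.re ≠ p.re) : exp (L * z) ≠ exp (L * p) := by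
  intro heq
  have := congrArg norm heq
  simp [norm_exp, hL.ne', h] at this

end expPole

/-- Subtracting a multiple of `g` lowers the order of the pole of `f`. -/
theorem exists_le_meromorphicOrderAt_sub_const_mul {f g : ℂ → ℂ} {p : ℂ} {n : ℤ}
    (hf : MeromorphicAt f p) (hg : MeromorphicAt g p)
    (hfn : (n : WithTop ℤ) ≤ meromorphicOrderAt f p) (hgn : meromorphicOrderAt g p = n) :
    ∃ c : ℂ, ((n + 1 : ℤ) : WithTop ℤ) ≤ meromorphicOrderAt (fun z => f z - c * g z) p := by
  have hg0 : ∀ᶠ z in 𝓝[≠] p, g z ≠ 0 :=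
    (meromorphicOrderAt_ne_top_iff_eventually_ne_zero hg).1 (by simp [hgn])
  have hq : MeromorphicAt (fun z => f z / g z) p := hf.div hg
  have hfq : meromorphicOrderAt f p = meromorphicOrderAt (fun z => f z / g z) p + n := by
    rw [← hgn, ← fun_meromorphicOrderAt_mul hq hg]
    refine meromorphicOrderAt_congr (hg0.mono fun z hz => ?_)
    exact (div_mul_cancel₀ _ hz).symm
  have hq0 : 0 ≤ meromorphicOrderAt (fun z => f z / g z) p := by
    rw [hfq] at hfn
    generalize meromorphicOrderAt (fun z => f z / g z) p = a at hfn ⊢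
    induction a with
    | top => simp
    | coe a => norm_cast at hfn ⊢; omega
  obtain ⟨c, hc⟩ := tendsto_nhds_of_meromorphicOrderAt_nonneg hq hq0
  have hqc : MeromorphicAt (fun z => f z / g z - c) p := hq.sub (MeromorphicAt.const c p)
  have hpos : 0 < meromorphicOrderAt (fun z => f z / g z - c) p := by
    rw [← tendsto_zero_iff_meromorphicOrderAt_pos hqc]
    simpa using hc.sub_const c
  refine ⟨c, ?_⟩
  have : meromorphicOrderAt (fun z => f z - c * g z) p =
      meromorphicOrderAt (fun z => f z / g z - c) p + n := by
    rw [← hgn, ← fun_meromorphicOrderAt_mul hqc hg]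
    refine meromorphicOrderAt_congr (hg0.mono fun z hz => ?_)
    simp only
    field_simp
  rw [this]
  generalize meromorphicOrderAt (fun z => f z / g z - c) p = a at hpos ⊢
  induction a with
  | top => simp
  | coe a => norm_cast at hpos ⊢; omega

/-- A periodic meromorphic function without poles in a strip has the same integral over one
period along both boundary lines. -/
theorem integral_eq_integral_of_meromorphicOrderAt_nonneg {T r₁ r₂ : ℝ} (hT : 0 < T)
    (hr : r₁ < r₂) {U : Set ℂ} (hU : {z : ℂ | r₁ ≤ z.re ∧ z.re ≤ r₂} ⊆ U) {f : ℂ → ℂ}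
    (hf : MeromorphicOn f U)
    (hper : ∀ z : ℂ, r₁ ≤ z.re → z.re ≤ r₂ → f (z + I * T) = f z)
    (hlines : ∀ z : ℂ, z.re = r₁ ∨ z.re = r₂ → AnalyticAt ℂ f z)
    (hord : ∀ z : ℂ, r₁ ≤ z.re → z.re ≤ r₂ → 0 ≤ z.im → z.im < T → 0 ≤ meromorphicOrderAt f z) :
    (∫ t in (0:ℝ)..T, f (r₂ + t * I)) = ∫ t in (0:ℝ)..T, f (r₁ + t * I) := by
  set g := toMeromorphicNFOn f U with hg
  have hper_ev : ∀ z : ℂ, r₁ < z.re → z.re < r₂ → ∀ᶠ w in 𝓝 z, f (w + I * T) = f w := by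
    intro z h1 h2
    filter_upwards [continuous_re.continuousAt.eventually (Ioo_mem_nhds h1 h2)] with w hw
    exact hper w hw.1.le hw.2.le
  have hord' : ∀ z : ℂ, r₁ ≤ z.re → z.re ≤ r₂ → 0 ≤ z.im → z.im ≤ T →
      0 ≤ meromorphicOrderAt f z := by
    intro z h1 h2 h3 h4
    by_cases hl : z.re = r₁ ∨ z.re = r₂
    · exact (hlines z hl).meromorphicOrderAt_nonneg
    push Not at hl
    rcases h4.lt_or_eq with h4 | h4
    · exact hord z h1 h2 h3 h4
    have h0 := hord (z - I * T) (by simpa using h1) (by simpa using h2) (by simp [h4])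
      (by simp [h4, hT])
    have hev := hper_ev (z - I * T) (by simpa using lt_of_le_of_ne h1 hl.1.symm)
      (by simpa using lt_of_le_of_ne h2 hl.2)
    rw [← meromorphicOrderAt_congr (hev.filter_mono nhdsWithin_le_nhds)] at h0
    have := meromorphicOrderAt_comp_add_const_eq_meromorphicOrderAt (f := f) (c := I * T)
      (x := z - I * T)
    rw [sub_add_cancel] at this
    exact h0.trans_eq this
  have hga : ∀ z : ℂ, r₁ ≤ z.re → z.re ≤ r₂ → 0 ≤ z.im → z.im ≤ T → AnalyticAt ℂ g z := by
    intro z h1 h2 h3 h4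
    have hz : z ∈ U := hU ⟨h1, h2⟩
    rw [← (meromorphicNFOn_toMeromorphicNFOn f U hz).meromorphicOrderAt_nonneg_iff_analyticAt,
      meromorphicOrderAt_toMeromorphicNFOn hf hz]
    exact hord' z h1 h2 h3 h4
  have hgf : ∀ z : ℂ, z.re = r₁ ∨ z.re = r₂ → g z = f z := by
    intro z hz
    have hzU : z ∈ U := hU (by rcases hz with h | h <;> simp [h, hr.le])
    rw [hg, toMeromorphicNFOn_eq_toMeromorphicNFAt hf hzU,
      toMeromorphicNFAt_eq_self.2 (hlines z hz).meromorphicNFAt]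
  have hgper : ∀ z : ℂ, r₁ ≤ z.re → z.re ≤ r₂ → z.im = 0 → g (z + I * T) = g z := by
    intro z h1 h2 h3
    by_cases hl : z.re = r₁ ∨ z.re = r₂
    · rw [hgf _ (by simpa using hl), hgf z hl, hper z h1 h2]
    push Not at hl
    have hz : z ∈ U := hU ⟨h1, h2⟩
    have hz' : z + I * T ∈ U := hU (by simp [h1, h2])
    have e1 := hf.toMeromorphicNFOn_eq_self_on_nhdsNE hz
    have e2 := hf.toMeromorphicNFOn_eq_self_on_nhdsNE hz'
    have ht : Tendsto (fun w => w + I * T) (𝓝[≠] z) (𝓝[≠] (z + I * T)) := by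
      refine tendsto_nhdsWithin_of_tendsto_nhds_of_eventually_within _
        (Continuous.tendsto' (by fun_prop) _ _ rfl |>.mono_left nhdsWithin_le_nhds) ?_
      filter_upwards [self_mem_nhdsWithin] with w hw
      simpa using hw
    have e3 := (hper_ev z (lt_of_le_of_ne h1 hl.1.symm) (lt_of_le_of_ne h2 hl.2)).filter_mono
      (nhdsWithin_le_nhds (s := {z}ᶜ))
    have e : (fun w => g (w + I * T)) =ᶠ[𝓝[≠] z] g := by
      filter_upwards [e1, ht.eventually e2, e3] with w e1 e2 e3
      rw [hg, e1, e2, e3]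
    have c1 := (hga z h1 h2 h3.ge (by rw [h3]; exact hT.le)).continuousAt
    have c2 := (hga (z + I * T) (by simpa using h1) (by simpa using h2)
      (by simp [h3, hT.le]) (by simp [h3])).continuousAt
    have c3 : ContinuousAt (fun w => g (w + I * T)) z :=
      ContinuousAt.comp (f := fun w => w + I * T) (x := z) c2 (by fun_prop)
    exact tendsto_nhds_unique_of_eventuallyEq (c3.tendsto.mono_left nhdsWithin_le_nhds)
      (c1.tendsto.mono_left nhdsWithin_le_nhds) e
  have hrect := integral_boundary_rect_eq_zero_of_differentiableOn g (r₁ : ℂ) (r₂ + T * I) (by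
    intro z hz
    simp [mem_reProdIm, uIcc_of_le hr.le, uIcc_of_le hT.le] at hz
    exact (hga z hz.1.1 hz.1.2 hz.2.1 hz.2.2).differentiableAt.differentiableWithinAt)
  have hhor : ∫ x in r₁..r₂, g (x + T * I) = ∫ x in r₁..r₂, g x := by
    refine intervalIntegral.integral_congr fun x hx => ?_
    rw [uIcc_of_le hr.le] at hx
    simp only [mul_comm (T : ℂ) I]
    exact hgper x (by simpa using hx.1) (by simpa using hx.2) (by simp)
  have e2 (t : ℝ) : g (r₂ + t * I) = f (r₂ + t * I) := hgf _ (by simp)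
  have e1 (t : ℝ) : g (r₁ + t * I) = f (r₁ + t * I) := hgf _ (by simp)
  simp [hhor, e1, e2, sub_eq_zero] at hrect
  exact hrect

/-- The residue theorem for a periodic meromorphic function on a vertical strip, by induction on
the total order `n` of the poles. -/
theorem exists_hasResidue_integral_sub_integral {L T r₁ r₁₂ r₂ : ℝ} (hL : 0 < L)
    (hLT : L * T = 2 * Real.pi) (h₁ : r₁ < r₁₂) (h₂ : r₁₂ < r₂) {U : Set ℂ}
    (hU : {z : ℂ | r₁ ≤ z.re ∧ z.re ≤ r₂} ⊆ U) (S : Finset ℂ)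
    (hS : ∀ p ∈ S, p.re = r₁₂ ∧ 0 ≤ p.im ∧ p.im < T) (n : ℂ → ℕ) (hnS : ∀ z ∉ S, n z = 0)
    {f : ℂ → ℂ} (hf : MeromorphicOn f U)
    (hper : ∀ z : ℂ, r₁ ≤ z.re → z.re ≤ r₂ → f (z + I * T) = f z)
    (hlines : ∀ z : ℂ, z.re = r₁ ∨ z.re = r₂ → AnalyticAt ℂ f z)
    (hord : ∀ z : ℂ, r₁ ≤ z.re → z.re ≤ r₂ → 0 ≤ z.im → z.im < T →
      ((-n z : ℤ) : WithTop ℤ) ≤ meromorphicOrderAt f z) :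
    ∃ R : ℂ → ℂ, (∀ p ∈ S, HasResidue f p (R p)) ∧
      (∫ t in (0:ℝ)..T, f (r₂ + t * I)) - (∫ t in (0:ℝ)..T, f (r₁ + t * I)) =
        2 * Real.pi * ∑ p ∈ S, R p := by
  have hT : 0 < T := by
    by_contra! h
    nlinarith [Real.pi_pos]
  have hmem : ∀ p ∈ S, p ∈ U := fun p hp =>
    hU ⟨by rw [(hS p hp).1]; exact h₁.le, by rw [(hS p hp).1]; exact h₂.le⟩
  induction hN : ∑ p ∈ S, n p generalizing n f with
  | zero =>
    have hn : ∀ z, n z = 0 := fun z => by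
      by_cases hz : z ∈ S
      · exact Finset.sum_eq_zero_iff.1 hN z hz
      · exact hnS z hz
    have hord' : ∀ z : ℂ, r₁ ≤ z.re → z.re ≤ r₂ → 0 ≤ z.im → z.im < T →
        0 ≤ meromorphicOrderAt f z := fun z a b c d => by simpa [hn] using hord z a b c d
    refine ⟨0, fun p hp => ?_, ?_⟩
    · have := hS p hp
      exact .of_meromorphicOrderAt_nonneg (hf p (hmem p hp))
        (hord' p (by linarith) (by linarith) this.2.1 this.2.2)
    · rw [integral_eq_integral_of_meromorphicOrderAt_nonneg hT (h₁.trans h₂) hU hf hper hlines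
        hord']
      simp
  | succ N ih =>
    obtain ⟨p, hp, hnp⟩ : ∃ p ∈ S, n p ≠ 0 := by
      by_contra! h
      rw [Finset.sum_eq_zero h] at hN
      omega
    obtain ⟨k, hk⟩ := Nat.exists_eq_succ_of_ne_zero hnp
    obtain ⟨hpre, hp0, hpT⟩ := hS p hp
    set G := expPole L p (k + 1) with hG
    have hGm : ∀ z, MeromorphicAt G z := fun z => meromorphicAt_expPole
    have hGl : ∀ z : ℂ, z.re = r₁ ∨ z.re = r₂ → AnalyticAt ℂ G z := fun z hz =>
      analyticAt_expPole (exp_ne_exp_of_re_ne hL (by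
        rw [hpre]; rcases hz with h | h <;> rw [h]; exacts [h₁.ne, h₂.ne']))
    have hGa : ∀ z : ℂ, 0 ≤ z.im → z.im < T → z ≠ p → AnalyticAt ℂ G z := fun z a b hne =>
      analyticAt_expPole fun h => hne (eq_of_exp_eq hL hLT a b hp0 hpT h)
    have hfp : ((-(k + 1) : ℤ) : WithTop ℤ) ≤ meromorphicOrderAt f p := by
      have := hord p (by linarith) (by linarith) hp0 hpT
      rw [hk] at this
      exact_mod_cast this
    obtain ⟨c, hc⟩ := exists_le_meromorphicOrderAt_sub_const_mul (hf p (hmem p hp)) (hGm p) hfp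
      (by simpa using meromorphicOrderAt_expPole (p := p) (k := k + 1) hL)
    obtain ⟨R, hR, hRint⟩ := ih (Function.update n p k) (f := fun z => f z - c * G z)
      (fun z hz => by
        rw [Function.update_of_ne (by rintro rfl; exact hz hp)]; exact hnS z hz)
      (fun z hz => (hf z hz).sub ((MeromorphicAt.const c z).mul (hGm z)))
      (fun z a b => by rw [hper z a b, hG, expPole_add_period hLT])
      (fun z hz => (hlines z hz).sub (analyticAt_const.mul (hGl z hz)))
      (fun z a b h0 h1 => by
        by_cases hz : z = p
        · subst hz
          rw [Function.update_self]
          convert hc using 2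
          ring
        · rw [Function.update_of_ne hz]
          have hzm := hf z (hU ⟨a, b⟩)
          have hcG : AnalyticAt ℂ (fun z => -(c * G z)) z :=
            (analyticAt_const.mul (hGa z h0 h1 hz)).neg
          have := meromorphicOrderAt_add hzm hcG.meromorphicAt
          simp only [sub_eq_add_neg]
          refine le_trans (le_min (hord z a b h0 h1) ?_) this
          refine le_trans ?_ hcG.meromorphicOrderAt_nonneg
          exact_mod_cast (by omega : (-n z : ℤ) ≤ 0))
      (by
        have e1 := Finset.sum_update_of_mem hp n k
        rw [← Finset.add_sum_erase _ _ hp, Finset.erase_eq, hk] at hN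
        omega)
    obtain ⟨ρ, hρ, hρint⟩ : ∃ ρ : ℂ, HasResidue G p ρ ∧
        (∫ t in (0:ℝ)..T, G (r₂ + t * I)) - (∫ t in (0:ℝ)..T, G (r₁ + t * I)) =
          2 * Real.pi * ρ := by
      rcases k with _ | k
      · refine ⟨_, hasResidue_expPole_one hL, ?_⟩
        simp only [hG, zero_add]
        rw [integral_expPole_one_of_re_lt hL hLT (by rwa [hpre]),
          integral_expPole_one_of_lt_re hL hLT (by rwa [hpre]), sub_zero]
      · refine ⟨0, hasResidue_expPole_of_two_le hL, ?_⟩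
        simp only [hG, add_assoc, Nat.reduceAdd]
        rw [integral_expPole_of_two_le hL hLT, integral_expPole_of_two_le hL hLT]
        simp
    have hint : ∀ {h : ℂ → ℂ} {r : ℝ}, (∀ z : ℂ, z.re = r → AnalyticAt ℂ h z) →
        IntervalIntegrable (fun t : ℝ => h (r + t * I)) MeasureTheory.volume 0 T := by
      intro h r hh
      refine Continuous.intervalIntegrable (continuous_iff_continuousAt.2 fun t => ?_) _ _
      exact ContinuousAt.comp (f := fun t : ℝ => (r + t * I : ℂ)) (x := t)
        (hh _ (by simp)).continuousAt (by fun_prop)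
    refine ⟨fun s => R s + (Pi.single p (c * ρ) : ℂ → ℂ) s, fun s hs => ?_, ?_⟩
    · have hGs : HasResidue G s ((Pi.single p ρ : ℂ → ℂ) s) := by
        by_cases hsp : s = p
        · subst hsp; simpa using hρ
        · rw [Pi.single_eq_of_ne hsp]
          exact .of_meromorphicOrderAt_nonneg (hGm s)
            (hGa s (hS s hs).2.1 (hS s hs).2.2 hsp).meromorphicOrderAt_nonneg
      have := (hR s hs).add (hGs.const_mul c)
      simp only [sub_add_cancel] at this
      convert this using 2
      by_cases hsp : s = p
      · subst hsp; simp
      · simp [hsp]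
    · rw [intervalIntegral.integral_sub (hint fun z hz => hlines z (.inr hz))
          ((hint fun z hz => hGl z (.inr hz)).const_mul c),
        intervalIntegral.integral_sub (hint fun z hz => hlines z (.inl hz))
          ((hint fun z hz => hGl z (.inl hz)).const_mul c),
        intervalIntegral.integral_const_mul, intervalIntegral.integral_const_mul] at hRint
      rw [Finset.sum_add_distrib, Finset.sum_pi_single' p, if_pos hp]
      linear_combination hRint + c * hρint

theorem isPole_iff_meromorphicOrderAt_neg {f : ℂ → ℂ} {p : ℂ} (hf : MeromorphicAt f p) :
    IsPole f p ↔ meromorphicOrderAt f p < 0 := by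
  rw [← tendsto_cobounded_iff_meromorphicOrderAt_neg hf, IsPole, tendsto_norm_atTop_iff_cobounded]

theorem MeromorphicOn.finite_meromorphicOrderAt_neg {f : ℂ → ℂ} {K : Set ℂ} (hK : IsCompact K)
    (hf : MeromorphicOn f K) : {p ∈ K | meromorphicOrderAt f p < 0}.Finite := by
  refine ((MeromorphicOn.divisor f K).finiteSupport hK).subset fun p hp => ?_
  rw [Function.mem_support, MeromorphicOn.divisor_apply hf hp.1]
  have h := hp.2
  generalize meromorphicOrderAt f p = a at h
  induction a with
  | top => simp at h
  | coe a => norm_cast at h; simpa using h.ne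

/-- (One-variable core of Proposition 3.6, contour shift.) If `f` is meromorphic on a
neighborhood of the closed strip `r₁ ≤ Re z ≤ r₂`, periodic with period `iT` where
`T = 2π / log q`, holomorphic on the two boundary lines, and all its poles in the strip
have real part `r₁₂`, then the set `P` of poles with real part `r₁₂` and imaginary part in
`[0, T)` is finite and the difference of the two vertical line integrals equals
`2π` times the sum of the residues at the points of `P`. -/
theorem statement1
    (q : ℝ) (hq : 1 < q)
    (T : ℝ) (hT : T = 2 * Real.pi / Real.log q)
    (r₁ r₁₂ r₂ : ℝ) (h₁ : r₁ < r₁₂) (h₂ : r₁₂ < r₂)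
    (U : Set ℂ) (hU : IsOpen U)
    (hUstrip : {z : ℂ | r₁ ≤ z.re ∧ z.re ≤ r₂} ⊆ U)
    (f : ℂ → ℂ) (hf : MeromorphicOn f U)
    (hper : ∀ z : ℂ, r₁ ≤ z.re → z.re ≤ r₂ → f (z + Complex.I * T) = f z)
    (hlines : ∀ z : ℂ, z.re = r₁ ∨ z.re = r₂ → AnalyticAt ℂ f z)
    (hpoles : ∀ p : ℂ, r₁ ≤ p.re → p.re ≤ r₂ → IsPole f p → p.re = r₁₂)
    (Res : ℂ → ℂ)
    (hRes : ∀ p : ℂ, IsPole f p → ∃ ε₀ > (0 : ℝ), ∀ ε : ℝ, 0 < ε → ε < ε₀ →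
      (∮ z in C(p, ε), f z) = 2 * Real.pi * Complex.I * Res p) :
    {p : ℂ | IsPole f p ∧ p.re = r₁₂ ∧ 0 ≤ p.im ∧ p.im < T}.Finite ∧
    (∫ t in (0:ℝ)..T, f (r₂ + t * Complex.I)) - (∫ t in (0:ℝ)..T, f (r₁ + t * Complex.I)) =
      2 * Real.pi *
        ∑ᶠ p ∈ {p : ℂ | IsPole f p ∧ p.re = r₁₂ ∧ 0 ≤ p.im ∧ p.im < T}, Res p := by
  have hlog : 0 < Real.log q := Real.log_pos hq
  have hLT : Real.log q * T = 2 * Real.pi := by rw [hT]; field_simp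
  have hmer : ∀ z : ℂ, r₁ ≤ z.re → z.re ≤ r₂ → MeromorphicAt f z := fun z a b =>
    hf z (hUstrip ⟨a, b⟩)
  have hfin : {p : ℂ | IsPole f p ∧ p.re = r₁₂ ∧ 0 ≤ p.im ∧ p.im < T}.Finite := by
    have hK : IsCompact (Icc r₁ r₂ ×ℂ Icc 0 T) := isCompact_Icc.reProdIm isCompact_Icc
    refine (MeromorphicOn.finite_meromorphicOrderAt_neg hK
      fun z hz => hmer z hz.1.1 hz.1.2).subset ?_
    rintro p ⟨hp, hre, h0, h1⟩
    have a : r₁ ≤ p.re := by linarith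
    have b : p.re ≤ r₂ := by linarith
    exact ⟨⟨⟨a, b⟩, h0, h1.le⟩, (isPole_iff_meromorphicOrderAt_neg (hmer p a b)).1 hp⟩
  refine ⟨hfin, ?_⟩
  set n : ℂ → ℕ := fun z =>
    if z ∈ hfin.toFinset then (-(meromorphicOrderAt f z).untop₀).toNat else 0 with hn
  obtain ⟨R, hR, hint⟩ := exists_hasResidue_integral_sub_integral hlog hLT h₁ h₂ hUstrip
    hfin.toFinset (fun p hp => ((hfin.mem_toFinset).1 hp).2) n (fun z hz => if_neg hz) hf hper
    hlines (fun z a b h0 h1 => by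
      by_cases hz : z ∈ hfin.toFinset
      · rw [hn]
        simp only [if_pos hz]
        generalize meromorphicOrderAt f z = m
        induction m with
        | top => simp
        | coe m =>
          rw [WithTop.untop₀_coe, WithTop.coe_le_coe]
          omega
      · simp only [hn, if_neg hz, Nat.cast_zero, neg_zero, WithTop.coe_zero]
        by_contra! hneg
        have hpole := (isPole_iff_meromorphicOrderAt_neg (hmer z a b)).2 hneg
        exact hz (hfin.mem_toFinset.2 ⟨hpole, hpoles z a b hpole, h0, h1⟩))
  rw [hint, finsum_mem_eq_finite_toFinset_sum _ hfin]
  congr 1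
  refine Finset.sum_congr rfl fun p hp => ?_
  obtain ⟨ε₀, hε₀, hres⟩ := hRes p (hfin.mem_toFinset.1 hp).1
  obtain ⟨ε, ⟨-, hε⟩, hε'⟩ := ((hR p hp).and (Ioo_mem_nhdsGT hε₀)).exists
  exact mul_left_cancel₀ two_pi_I_ne_zero (hε.symm.trans (hres ε hε'.1 hε'.2))
end

section
/- (Lemma 3.3, in torus coordinates.) Let A' and A'' be cosets of subtori of (ℂ^×)^n such that A'' is not contained in A'. Then there exists a Laurent polynomial f ∈ ℂ[z₁^{±1}, …, z_n^{±1}] whose associated function on (ℂ^×)^n vanishes identically on A' but does not vanish identically on A''. -/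
/-- A subtorus of `(ℂˣ)ⁿ` is the image of a monomial group homomorphism `(ℂˣ)ʳ → (ℂˣ)ⁿ`
given by an integer matrix. -/
def IsSubtorus {n : ℕ} (T : Set (Fin n → ℂˣ)) : Prop :=
  ∃ (r : ℕ) (c : Fin n → Fin r → ℤ),
    T = Set.range (fun w : Fin r → ℂˣ => fun i => ∏ j, (w j) ^ (c i j))

/-- A coset `a · T` of a subtorus `T` of `(ℂˣ)ⁿ` (multiplication is coordinatewise). -/
def IsSubtorusCoset {n : ℕ} (A : Set (Fin n → ℂˣ)) : Prop :=
  ∃ (a : Fin n → ℂˣ) (T : Set (Fin n → ℂˣ)), IsSubtorus T ∧ A = (fun t => a * t) '' T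

/-- Evaluation of a Laurent polynomial (a finitely supported family of coefficients indexed
by `ℤⁿ`) at a point of `(ℂˣ)ⁿ`. -/
noncomputable def laurentEval {n : ℕ} (f : (Fin n → ℤ) →₀ ℂ) (z : Fin n → ℂˣ) : ℂ :=
  f.sum fun e c => c * ((∏ i, z i ^ e i : ℂˣ) : ℂ)

/-- The unit group of an algebraically closed field is divisible. -/
noncomputable abbrev divisibleByIntUnits (K : Type*) [Field K] [IsAlgClosed K] :
    DivisibleBy (Additive Kˣ) ℤ :=
  letI : DivisibleBy (Additive Kˣ) ℕ :=
    divisibleByOfSMulRightSurj _ _ fun {k} hk u => by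
      obtain ⟨x, hx⟩ := IsAlgClosed.exists_pow_nat_eq (u.toMul : K) (Nat.pos_of_ne_zero hk)
      have hx0 : x ≠ 0 := by
        rintro rfl
        exact u.toMul.ne_zero (by rw [← hx, zero_pow hk])
      exact ⟨Additive.ofMul (Units.mk0 x hx0),
        Additive.toMul.injective (Units.ext (by simpa using hx))⟩
  AddGroup.divisibleByIntOfDivisibleByNat _

/-- A linear map to a divisible group which kills the kernel of `φ` factors through `φ`. -/
theorem exists_comp_eq_of_ker_le {M N Q : Type*} [AddCommGroup M] [AddCommGroup N]
    [AddCommGroup Q] [DivisibleBy Q ℤ] (φ : M →ₗ[ℤ] N) (g : M →ₗ[ℤ] Q)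
    (h : LinearMap.ker φ ≤ LinearMap.ker g) : ∃ w : N →ₗ[ℤ] Q, w ∘ₗ φ = g := by
  obtain ⟨w, hw⟩ := (Module.Baer.of_divisible Q).extension_property
    ((LinearMap.ker φ).liftQ φ le_rfl)
    (LinearMap.ker_eq_bot.mp (Submodule.ker_liftQ_eq_bot' _ φ rfl))
    ((LinearMap.ker φ).liftQ g h)
  refine ⟨w, LinearMap.ext fun m => ?_⟩
  simpa using LinearMap.congr_fun hw ((LinearMap.ker φ).mkQ m)

/-- The additive form of the character evaluation `m ↦ ∏ i, z i ^ m i`. -/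
theorem linearCombination_ofMul {n : ℕ} (z : Fin n → ℂˣ) (m : Fin n → ℤ) :
    Fintype.linearCombination ℤ (fun i => Additive.ofMul (z i)) m =
      Additive.ofMul (∏ i, z i ^ m i) := by
  simp [Fintype.linearCombination_apply, ofMul_prod]

theorem prod_zpow_eq_zpow_sum {ι G : Type*} [CommGroup G] (s : Finset ι) (e : ι → ℤ) (x : G) :
    ∏ i ∈ s, x ^ e i = x ^ ∑ i ∈ s, e i := by
  classical
  induction s using Finset.induction_on with
  | empty => simp
  | insert i s hi ih => rw [Finset.prod_insert hi, Finset.sum_insert hi, ih, zpow_add]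

/-- A point outside a subtorus is separated from it by a character. -/
theorem IsSubtorus.exists_character {n : ℕ} {T : Set (Fin n → ℂˣ)} (hT : IsSubtorus T)
    {z : Fin n → ℂˣ} (hz : z ∉ T) :
    ∃ m : Fin n → ℤ, (∀ t ∈ T, ∏ i, t i ^ m i = 1) ∧ ∏ i, z i ^ m i ≠ 1 := by
  obtain ⟨r, c, rfl⟩ := hT
  by_contra! H
  let φ : (Fin n → ℤ) →ₗ[ℤ] (Fin r → ℤ) := Fintype.linearCombination ℤ c
  let g : (Fin n → ℤ) →ₗ[ℤ] Additive ℂˣ :=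
    Fintype.linearCombination ℤ fun i => Additive.ofMul (z i)
  let := divisibleByIntUnits ℂ
  obtain ⟨w, hw⟩ := exists_comp_eq_of_ker_le φ g fun m hm => by
    have hm' : ∀ j, ∑ i, m i * c i j = 0 := fun j => by
      simpa [φ, Fintype.linearCombination_apply] using congr_fun (LinearMap.mem_ker.mp hm) j
    rw [LinearMap.mem_ker, linearCombination_ofMul, ofMul_eq_zero]
    refine H m ?_
    rintro _ ⟨u, rfl⟩
    simp only [← Finset.prod_zpow]
    rw [Finset.prod_comm]
    refine Finset.prod_eq_one fun j _ => ?_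
    simp only [← zpow_mul]
    rw [prod_zpow_eq_zpow_sum, ← zpow_zero (u j), ← hm' j]
    simp only [mul_comm]
  refine hz ⟨fun j => (w (Pi.single j 1)).toMul, funext fun i => ?_⟩
  have hi : w (c i) = Additive.ofMul (z i) := by
    simpa [φ, g] using LinearMap.congr_fun hw (Pi.single i 1)
  apply Additive.ofMul.injective
  rw [← hi, LinearMap.pi_apply_eq_sum_univ w (c i), ofMul_prod]
  refine Finset.sum_congr rfl fun j _ => ?_
  rw [ofMul_zpow, ofMul_toMul]
  congr 2
  ext k
  simp [Pi.single_apply, eq_comm]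

/-- The binomial `z ^ m - b` evaluates as expected. -/
theorem laurentEval_single_sub_single {n : ℕ} (m : Fin n → ℤ) (b : ℂ) (z : Fin n → ℂˣ) :
    laurentEval (Finsupp.single m 1 - Finsupp.single 0 b) z =
      ((∏ i, z i ^ m i : ℂˣ) : ℂ) - b := by
  rw [laurentEval, Finsupp.sum_sub_index fun _ _ _ => sub_mul _ _ _,
    Finsupp.sum_single_index (zero_mul _), Finsupp.sum_single_index (zero_mul _)]
  simp

/-- (Lemma 3.3, in torus coordinates.) If `A'`, `A''` are cosets of subtori of `(ℂˣ)ⁿ` and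
`A''` is not contained in `A'`, then there is a Laurent polynomial vanishing identically on
`A'` but not identically on `A''`. -/
theorem statement3 {n : ℕ} (hn : 1 ≤ n)
    (A' A'' : Set (Fin n → ℂˣ))
    (hA' : IsSubtorusCoset A') (hA'' : IsSubtorusCoset A'')
    (hnsub : ¬ A'' ⊆ A') :
    ∃ f : (Fin n → ℤ) →₀ ℂ,
      (∀ z ∈ A', laurentEval f z = 0) ∧ ∃ z ∈ A'', laurentEval f z ≠ 0 := by
  obtain ⟨z, hz, hzA'⟩ := Set.not_subset.mp hnsub
  obtain ⟨a, T, hT, rfl⟩ := hA'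
  obtain ⟨m, hm, hmz⟩ := hT.exists_character (z := a⁻¹ * z) fun h =>
    hzA' ⟨_, h, mul_inv_cancel_left a z⟩
  refine ⟨Finsupp.single m 1 - Finsupp.single 0 ((∏ i, a i ^ m i : ℂˣ) : ℂ), ?_, z, hz, ?_⟩
  · rintro _ ⟨t, ht, rfl⟩
    simp only [laurentEval_single_sub_single, Pi.mul_apply, mul_zpow, Finset.prod_mul_distrib,
      hm t ht, mul_one, sub_self]
  · rw [laurentEval_single_sub_single, sub_ne_zero]
    refine fun h => hmz ?_
    simp only [Pi.mul_apply, Pi.inv_apply, mul_zpow, inv_zpow, Finset.prod_mul_distrib,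
      Finset.prod_inv_distrib, Units.ext h, inv_mul_cancel]
end

section
/- (First lemma of 3.8.) Let a ∈ (ℂ^×)^n and let β₀ ∈ ℕ^m be a multi-index. Then there exists a Laurent polynomial ψ ∈ ℂ[z₁^{±1},…,z_n^{±1}] such that (∂^{β₀}ψ_a)(0) ≠ 0 while (∂^{β}ψ_a)(0) = 0 for every multi-index β ∈ ℕ^m with β ≠ β₀ and |β| ≤ |β₀|. -/
/-- Evaluation of a Laurent polynomial (a finitely supported family of coefficients indexed
by `ℤⁿ`) at a point of `ℂⁿ` with nonzero coordinates (using `zpow` on the field `ℂ`). -/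
noncomputable def laurentEvalC {n : ℕ} (f : (Fin n → ℤ) →₀ ℂ) (z : Fin n → ℂ) : ℂ :=
  f.sum fun e c => c * ∏ i, z i ^ e i

/-- The point `b ⊙ e(λ)` of `ℂⁿ`: its `j`-th coordinate is `b j · exp(λ j · log q)` for
`j < m` and `b j` for `m ≤ j`. -/
noncomputable def emap {n : ℕ} (m : ℕ) (q : ℝ) (b : Fin n → ℂ) (lam : Fin m → ℂ) :
    Fin n → ℂ :=
  fun j => if h : (j : ℕ) < m then b j * Complex.exp (lam ⟨j, h⟩ * Real.log q) else b j

/-- The partial derivative of `f : ℂᵐ → ℂ` in the `i`-th coordinate direction. -/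
noncomputable def pderivC {m : ℕ} (i : Fin m) (f : (Fin m → ℂ) → ℂ) : (Fin m → ℂ) → ℂ :=
  fun x => fderiv ℂ f x (Pi.single i 1)

/-- The iterated partial derivative `∂^β` of `f : ℂᵐ → ℂ` for a multi-index `β ∈ ℕᵐ`. -/
noncomputable def mderiv {m : ℕ} (β : Fin m → ℕ) (f : (Fin m → ℂ) → ℂ) :
    (Fin m → ℂ) → ℂ :=
  (List.finRange m).foldr (fun i g => (pderivC i)^[β i] g) f

theorem pderivC_expSum {m : ℕ} {κ : Type*} (s : Finset κ) (c : κ → ℂ) (v : κ → Fin m → ℂ)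
    (i : Fin m) :
    pderivC i (fun x => ∑ k ∈ s, c k * Complex.exp (∑ j, v k j * x j)) =
      fun x => ∑ k ∈ s, (v k i * c k) * Complex.exp (∑ j, v k j * x j) := by
  funext x
  have hlin : ∀ k, HasFDerivAt (fun y : Fin m → ℂ => ∑ j, v k j * y j)
      (∑ j, v k j • ContinuousLinearMap.proj (R := ℂ) (φ := fun _ : Fin m => ℂ) j) x := fun k =>
    HasFDerivAt.fun_sum fun j _ => (hasFDerivAt_apply j x).const_mul (v k j)
  have hsum := HasFDerivAt.fun_sum (u := s) fun k _ => ((hlin k).cexp).const_mul (c k)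
  rw [pderivC, hsum.fderiv]
  simp only [sum_apply, smul_apply,
    ContinuousLinearMap.proj_apply, smul_eq_mul, Pi.single_apply, mul_ite, mul_one, mul_zero,
    Finset.sum_ite_eq', Finset.mem_univ, if_true]
  exact Finset.sum_congr rfl fun k _ => by ring

theorem pderivC_iterate_expSum {m : ℕ} {κ : Type*} (s : Finset κ) (c : κ → ℂ)
    (v : κ → Fin m → ℂ) (i : Fin m) (b : ℕ) :
    (pderivC i)^[b] (fun x => ∑ k ∈ s, c k * Complex.exp (∑ j, v k j * x j)) =
      fun x => ∑ k ∈ s, (v k i ^ b * c k) * Complex.exp (∑ j, v k j * x j) := by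
  induction b with
  | zero => simp
  | succ b ih =>
    rw [Function.iterate_succ_apply', ih, pderivC_expSum]
    simp only [pow_succ', mul_assoc]

theorem mderiv_expSum {m : ℕ} {κ : Type*} (s : Finset κ) (c : κ → ℂ) (v : κ → Fin m → ℂ)
    (β : Fin m → ℕ) :
    mderiv β (fun x => ∑ k ∈ s, c k * Complex.exp (∑ j, v k j * x j)) =
      fun x => ∑ k ∈ s, ((∏ i, v k i ^ β i) * c k) * Complex.exp (∑ j, v k j * x j) := by
  have hfold : ∀ l : List (Fin m),
      l.foldr (fun i g => (pderivC i)^[β i] g)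
          (fun x => ∑ k ∈ s, c k * Complex.exp (∑ j, v k j * x j)) =
        fun x => ∑ k ∈ s, ((l.map fun i => v k i ^ β i).prod * c k) *
          Complex.exp (∑ j, v k j * x j) := by
    intro l
    induction l with
    | nil => simp
    | cons i l ih =>
      rw [List.foldr_cons, ih, pderivC_iterate_expSum]
      simp only [List.map_cons, List.prod_cons, mul_assoc]
  rw [mderiv, hfold]
  simp only [Fin.prod_univ_def]

/-- On distinct nodes there are weights dual to the monomial of degree `b₀`. -/
theorem exists_moment_weights {K : Type*} [Field K] {N : ℕ} {t : Fin N → K}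
    (ht : Function.Injective t) (b₀ : Fin N) :
    ∃ w : Fin N → K, ∀ b : Fin N, ∑ k, t k ^ (b : ℕ) * w k = if b = b₀ then 1 else 0 := by
  have hdet : IsUnit (Matrix.vandermonde t).det :=
    (Matrix.det_vandermonde_ne_zero_iff.2 ht).isUnit
  refine ⟨fun k => (Matrix.vandermonde t)⁻¹ b₀ k, fun b => ?_⟩
  have h := congrFun (congrFun (Matrix.nonsing_inv_mul _ hdet) b₀) b
  simp only [Matrix.mul_apply, Matrix.vandermonde_apply, Matrix.one_apply] at h
  simp only [mul_comm (t _ ^ _), h, eq_comm]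

/-- Every exponential sum with frequencies in `log q • ℕᵐ` is `ψ_a` for a Laurent
polynomial `ψ`. -/
theorem exists_laurentEvalC_emap_eq {n m : ℕ} (hnm : m ≤ n) (q : ℝ) (a : Fin n → ℂˣ)
    {κ : Type*} (s : Finset κ) (c : κ → ℂ) (e : κ → Fin m → ℕ) :
    ∃ ψ : (Fin n → ℤ) →₀ ℂ, ∀ x : Fin m → ℂ,
      laurentEvalC ψ (emap m q (fun j => (a j : ℂ)) x) =
        ∑ k ∈ s, c k * Complex.exp (∑ j, ((e k j : ℂ) * Real.log q) * x j) := by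
  obtain ⟨r, rfl⟩ := Nat.exists_eq_add_of_le hnm
  refine ⟨∑ k ∈ s, Finsupp.single (Fin.append (fun j => (e k j : ℤ)) fun _ => 0)
    (c k * (∏ j, (a (Fin.castAdd r j) : ℂ) ^ e k j)⁻¹), fun x => ?_⟩
  rw [laurentEvalC, ← Finsupp.sum_finsetSum_index (by simp) (by intros; ring)]
  refine Finset.sum_congr rfl fun k _ => ?_
  have hprod : (∏ j, (a (Fin.castAdd r j) : ℂ) ^ e k j) ≠ 0 :=
    Finset.prod_ne_zero_iff.2 fun j _ => pow_ne_zero _ (Units.ne_zero _)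
  rw [Finsupp.sum_single_index (by simp), Fin.prod_univ_add]
  simp only [emap, Fin.append_left, Fin.append_right, Fin.val_castAdd, Fin.is_lt, dite_true,
    zpow_natCast, zpow_zero, Finset.prod_const_one, mul_one, mul_pow, Finset.prod_mul_distrib,
    Complex.exp_sum, ← Complex.exp_nat_mul]
  rw [mul_assoc, inv_mul_cancel_left₀ hprod]
  exact congrArg (c k * ·) (Finset.prod_congr rfl fun j _ => congrArg Complex.exp (by ring))


/-- (First lemma of 3.8.) For `a ∈ (ℂˣ)ⁿ` and a multi-index `β₀ ∈ ℕᵐ` there is a Laurent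
polynomial `ψ` with `(∂^{β₀} ψ_a)(0) ≠ 0` and `(∂^{β} ψ_a)(0) = 0` for every multi-index
`β ≠ β₀` of total degree at most `|β₀|`, where `ψ_b(λ) := ψ(b ⊙ e(λ))`. -/
theorem statement4 {n m : ℕ} (hm : 1 ≤ m) (hnm : m ≤ n)
    (q : ℝ) (hq : 1 < q)
    (a : Fin n → ℂˣ) (β₀ : Fin m → ℕ) :
    ∃ ψ : (Fin n → ℤ) →₀ ℂ,
      mderiv β₀ (fun lam => laurentEvalC ψ (emap m q (fun j => (a j : ℂ)) lam)) 0 ≠ 0 ∧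
      ∀ β : Fin m → ℕ, β ≠ β₀ → (∑ i, β i) ≤ (∑ i, β₀ i) →
        mderiv β (fun lam => laurentEvalC ψ (emap m q (fun j => (a j : ℂ)) lam)) 0 = 0 := by
  set N := ∑ i, β₀ i
  have hlog : (Real.log q : ℂ) ≠ 0 := Complex.ofReal_ne_zero.2 (Real.log_pos hq).ne'
  have hinj : Function.Injective fun k : Fin (N + 1) => ((k : ℕ) : ℂ) * Real.log q :=
    fun k l h => Fin.ext (Nat.cast_injective (mul_right_cancel₀ hlog h))
  have hlt : ∀ β : Fin m → ℕ, ∑ i, β i ≤ N → ∀ i, β i < N + 1 := fun β hβ i =>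
    Nat.lt_succ_of_le <|
      (Finset.single_le_sum (fun _ _ => Nat.zero_le _) (Finset.mem_univ i)).trans hβ
  choose w hw using fun i => exists_moment_weights hinj ⟨β₀ i, hlt β₀ le_rfl i⟩
  obtain ⟨ψ, hψ⟩ := exists_laurentEvalC_emap_eq hnm q a
    (Finset.univ : Finset (Fin m → Fin (N + 1))) (fun k => ∏ i, w i (k i)) fun k i => k i
  have key : ∀ β : Fin m → ℕ, ∑ i, β i ≤ N →
      mderiv β (fun lam => laurentEvalC ψ (emap m q (fun j => (a j : ℂ)) lam)) 0 =
        ∏ i, if β i = β₀ i then 1 else 0 := by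
    intro β hβ
    simp only [hψ]
    rw [mderiv_expSum]
    simp only [Pi.zero_apply, mul_zero, Finset.sum_const_zero, Complex.exp_zero, mul_one,
      ← Finset.prod_mul_distrib]
    rw [← Fintype.prod_sum fun i (k : Fin (N + 1)) =>
      (((k : ℕ) : ℂ) * Real.log q) ^ β i * w i k]
    exact Finset.prod_congr rfl fun i _ => by simpa using hw i ⟨β i, hlt β hβ i⟩
  refine ⟨ψ, by simp [key β₀ le_rfl], fun β hne hβ => ?_⟩
  obtain ⟨i, hi⟩ := Function.ne_iff.1 hne
  rw [key β hβ]
  exact Finset.prod_eq_zero (Finset.mem_univ i) (if_neg hi)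
end

section
/- (Algebraic core of the Lemma of Section 5.) Let p : ℝ^l → ℂ be a polynomial function, e ∈ E and e∨ a ℂ-linear functional on E. Then the function G → ℂ, m ↦ p(H(m)) · e∨(σ(m)e), is a matrix coefficient of a representation (σ̃, Ẽ) of G of finite length all of whose irreducible subquotients are isomorphic to (σ, E): there exist a complex representation (σ̃, Ẽ) of G, a vector ẽ ∈ Ẽ, a ℂ-linear functional ẽ∨ on Ẽ, and a finite chain 0 = F₀ ⊆ F₁ ⊆ ⋯ ⊆ F_r = Ẽ of σ̃-invariant subspaces with each quotient F_i/F_{i−1} isomorphic to (σ, E) as a representation of G, such that p(H(m)) · e∨(σ(m)e) = ẽ∨(σ̃(m)ẽ) for all m ∈ G. -/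
open Matrix in
/-- A function on `G` is a unipotent matrix coefficient if it has the form `g ↦ u ⬝ᵥ A g *ᵥ v` for
a representation `A` of `G` by upper triangular matrices with ones on the diagonal. -/
def IsUnipotentCoeff {G : Type*} [Group G] (f : G → ℂ) : Prop :=
  ∃ (n : ℕ) (A : G →* Matrix (Fin n) (Fin n) ℂ),
    (∀ g i j, j < i → A g i j = 0) ∧ (∀ g i, A g i i = 1) ∧
    ∃ u v : Fin n → ℂ, ∀ g, f g = u ⬝ᵥ A g *ᵥ v

namespace IsUnipotentCoeff

variable {G : Type*} [Group G]

open Matrix in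
/-- The matrix coefficients of an extension of `B` by `A`, given by the cocycle `C`. -/
theorem of_extension {m n : ℕ} (A : G →* Matrix (Fin m) (Fin m) ℂ)
    (B : G →* Matrix (Fin n) (Fin n) ℂ) (C : G → Matrix (Fin m) (Fin n) ℂ)
    (hA : ∀ g i j, j < i → A g i j = 0) (hA' : ∀ g i, A g i i = 1)
    (hB : ∀ g i j, j < i → B g i j = 0) (hB' : ∀ g i, B g i i = 1)
    (hC : ∀ g h, C (g * h) = A g * C h + C g * B h)
    (u₁ v₁ : Fin m → ℂ) (u₂ v₂ : Fin n → ℂ) :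
    IsUnipotentCoeff fun g => u₁ ⬝ᵥ A g *ᵥ v₁ + u₁ ⬝ᵥ C g *ᵥ v₂ + u₂ ⬝ᵥ B g *ᵥ v₂ := by
  have hC1 : C 1 = 0 := by simpa using hC 1 1
  let M : G →* Matrix (Fin m ⊕ Fin n) (Fin m ⊕ Fin n) ℂ :=
    { toFun := fun g => fromBlocks (A g) (C g) 0 (B g)
      map_one' := by simp [hC1]
      map_mul' := fun g h => by simp [fromBlocks_multiply, hC] }
  let e : Fin m ⊕ Fin n ≃ Fin (m + n) := finSumFinEquiv
  refine ⟨m + n, (reindexAlgEquiv ℂ ℂ e : _ →* _).comp M, ?_, ?_,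
    Sum.elim u₁ u₂ ∘ e.symm, Sum.elim v₁ v₂ ∘ e.symm, ?_⟩
  · intro g i j
    refine Fin.addCases (fun i => ?_) (fun i => ?_) i <;>
      refine Fin.addCases (fun j => ?_) (fun j => ?_) j <;> intro hij
    · simpa [M, e] using hA g i j hij
    · simp [Fin.lt_def] at hij
      omega
    · simp [M, e]
    · simpa [M, e] using hB g i j (by simpa using hij)
  · intro g i
    refine Fin.addCases (fun i => ?_) (fun i => ?_) i
    · simpa [M, e] using hA' g i
    · simpa [M, e] using hB' g i
  · intro g
    have h : ((reindexAlgEquiv ℂ ℂ e : _ →* _).comp M) g = (M g).submatrix e.symm e.symm := rfl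
    rw [h, submatrix_mulVec_equiv, ← comp_equiv_symm_dotProduct]
    simp [M, fromBlocks_mulVec, Function.comp_assoc, dotProduct_add, add_assoc]

theorem const (a : ℂ) : IsUnipotentCoeff fun _ : G => a :=
  ⟨1, 1, fun _ i j h => by omega, fun _ _ => by simp, fun _ => a, 1, fun _ => by
    simp [dotProduct]⟩

theorem add {f₁ f₂ : G → ℂ} (h₁ : IsUnipotentCoeff f₁) (h₂ : IsUnipotentCoeff f₂) :
    IsUnipotentCoeff fun g => f₁ g + f₂ g := by
  obtain ⟨m, A, hA, hA', u₁, v₁, h₁⟩ := h₁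
  obtain ⟨n, B, hB, hB', u₂, v₂, h₂⟩ := h₂
  simpa [h₁, h₂] using of_extension A B 0 hA hA' hB hB' (by simp) u₁ v₁ u₂ v₂

theorem mul_additive {f c : G → ℂ} (hf : IsUnipotentCoeff f)
    (hc : ∀ g h, c (g * h) = c g + c h) : IsUnipotentCoeff fun g => f g * c g := by
  obtain ⟨n, A, hA, hA', u, v, hf⟩ := hf
  have := of_extension A A (fun g => c g • A g) hA hA' hA hA'
    (fun g h => by simp [hc, add_smul, add_comm]) u 0 0 v
  simpa [hf, Matrix.smul_mulVec, mul_comm] using this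

theorem eval {ι : Type*} (c : G → ι → ℂ) (hc : ∀ g h i, c (g * h) i = c g i + c h i)
    (P : MvPolynomial ι ℂ) : IsUnipotentCoeff fun g => MvPolynomial.eval (c g) P := by
  induction P using MvPolynomial.induction_on with
  | C a => simpa using const a
  | add p q hp hq => simpa using hp.add hq
  | mul_X p i hp => simpa using hp.mul_additive (c := fun g => c g i) fun g h => hc g h i

end IsUnipotentCoeff

/-- The tensor product of a matrix representation `A` with `σ`, realised on `Fin n → E`. -/
def Representation.matrixTensor {G E : Type*} [Group G] [AddCommGroup E] [Module ℂ E] {n : ℕ}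
    (A : G →* Matrix (Fin n) (Fin n) ℂ) (σ : Representation ℂ G E) :
    Representation ℂ G (Fin n → E) where
  toFun g := LinearMap.pi fun i => ∑ j, A g i j • (σ g ∘ₗ LinearMap.proj j)
  map_one' := by
    ext x i
    simp [Matrix.one_apply]
  map_mul' g h := by
    refine LinearMap.ext fun x => funext fun i => ?_
    simp only [map_mul, Matrix.mul_apply, LinearMap.pi_apply, LinearMap.sum_apply,
      LinearMap.smul_apply, LinearMap.comp_apply, LinearMap.proj_apply, Module.End.mul_apply,
      map_sum, map_smul, Finset.sum_smul, Finset.smul_sum, smul_smul]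
    exact Finset.sum_comm

theorem Representation.matrixTensor_apply {G E : Type*} [Group G] [AddCommGroup E] [Module ℂ E]
    {n : ℕ} (A : G →* Matrix (Fin n) (Fin n) ℂ) (σ : Representation ℂ G E) (g : G)
    (x : Fin n → E) (i : Fin n) :
    σ.matrixTensor A g x i = ∑ j, A g i j • σ g (x j) := by
  simp [Representation.matrixTensor]

/-- The vectors in `Fin n → E` supported on the first `k` coordinates. -/
def initialCoords (E : Type*) [AddCommGroup E] [Module ℂ E] (n k : ℕ) :
    Submodule ℂ (Fin n → E) where
  carrier := {x | ∀ j : Fin n, k ≤ j → x j = 0}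
  add_mem' hx hy j hj := by simp [hx j hj, hy j hj]
  zero_mem' _ _ := rfl
  smul_mem' c x hx j hj := by simp [hx j hj]

theorem matrixTensor_mem_initialCoords {G E : Type*} [Group G] [AddCommGroup E] [Module ℂ E]
    {n k : ℕ} {A : G →* Matrix (Fin n) (Fin n) ℂ} (hA : ∀ g i j, j < i → A g i j = 0)
    (σ : Representation ℂ G E) (g : G) {x : Fin n → E} (hx : x ∈ initialCoords E n k) :
    σ.matrixTensor A g x ∈ initialCoords E n k := by
  intro i hi
  rw [Representation.matrixTensor_apply]
  refine Finset.sum_eq_zero fun j _ => ?_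
  rcases lt_or_ge j i with hj | hj
  · rw [hA g i j hj, zero_smul]
  · rw [hx j (hi.trans hj), map_zero, smul_zero]


/-- (Algebraic core of the Lemma of Section 5.) Let `G` be a group, `H : G → ℝˡ` a group
homomorphism into the additive group `ℝˡ`, and `(σ, E)` an irreducible complex
representation of `G`. For any polynomial function `p : ℝˡ → ℂ` (given by a multivariate
polynomial `P`), any `e ∈ E` and any linear functional `e' : E → ℂ`, the function
`g ↦ p(H g) · e'(σ g e)` is a matrix coefficient of a representation `(σ̃, Ẽ)` of `G` of
finite length, all of whose irreducible subquotients are isomorphic to `(σ, E)`. -/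
theorem statement7
    (G : Type) [Group G]
    (l : ℕ) (hl : 1 ≤ l)
    (H : G → (Fin l → ℝ))
    (hH : ∀ g₁ g₂ : G, H (g₁ * g₂) = H g₁ + H g₂)
    (E : Type) [AddCommGroup E] [Module ℂ E]
    (σ : Representation ℂ G E)
    (hnontriv : Nontrivial E)
    (hirr : ∀ p : Submodule ℂ E, (∀ g : G, ∀ x ∈ p, σ g x ∈ p) → p = ⊥ ∨ p = ⊤)
    (P : MvPolynomial (Fin l) ℂ)
    (e : E) (e' : E →ₗ[ℂ] ℂ) :
    ∃ (Et : ModuleCat.{0} ℂ) (σt : Representation ℂ G Et) (et : Et) (et' : Et →ₗ[ℂ] ℂ)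
      (r : ℕ) (F : Fin (r + 1) → Submodule ℂ Et)
      (hinv : ∀ (i : Fin (r + 1)) (g : G), ∀ x ∈ F i, σt g x ∈ F i),
      Monotone F ∧ F 0 = ⊥ ∧ F (Fin.last r) = ⊤ ∧
      (∀ i : Fin r, ∃ φ : ↥(F i.succ) →ₗ[ℂ] E,
        Function.Surjective φ ∧
        LinearMap.ker φ = Submodule.comap (F i.succ).subtype (F i.castSucc) ∧
        ∀ (g : G) (x : ↥(F i.succ)), φ ⟨σt g ↑x, hinv i.succ g ↑x x.2⟩ = σ g (φ x)) ∧
      (∀ g : G,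
        MvPolynomial.eval (fun i => ((H g i : ℝ) : ℂ)) P * e' (σ g e) = et' (σt g et)) := by
  obtain ⟨n, A, hA, hA', u, v, hf⟩ :=
    IsUnipotentCoeff.eval (fun g i => ((H g i : ℝ) : ℂ)) (fun g h i => by simp [hH]) P
  refine ⟨ModuleCat.of ℂ (Fin n → E), σ.matrixTensor A, fun j => v j • e,
    ∑ i, u i • (e' ∘ₗ LinearMap.proj i), n, fun k => initialCoords E n k,
    fun k g x hx => matrixTensor_mem_initialCoords hA σ g hx, ?_, ?_, ?_, ?_, ?_⟩
  · exact fun a b hab x hx j hj => hx j (le_trans hab hj)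
  · exact (Submodule.eq_bot_iff _).2 fun x hx => funext fun j => hx j (Nat.zero_le _)
  · exact (Submodule.eq_top_iff').2 fun x j hj => absurd j.2 (not_lt.2 hj)
  · intro i
    refine ⟨LinearMap.proj i ∘ₗ (initialCoords E n i.succ).subtype, ?_, ?_, ?_⟩
    · refine fun y => ⟨⟨Pi.single i y, fun j hj => ?_⟩, by simp⟩
      refine Pi.single_eq_of_ne (M := fun _ => E) (fun h => ?_) y
      simp [h] at hj
    · ext ⟨x, hx⟩
      refine ⟨fun h j hj => ?_, fun h => h i le_rfl⟩
      rcases eq_or_lt_of_le hj with hj | hj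
      · obtain rfl : i = j := Fin.ext hj
        exact h
      · exact hx j hj
    · rintro g ⟨x, hx⟩
      change σ.matrixTensor A g x i = σ g (x i)
      rw [Representation.matrixTensor_apply, Finset.sum_eq_single i, hA', one_smul]
      · intro j _ hj
        rcases lt_or_gt_of_ne hj with hj | hj
        · rw [hA g i j hj, zero_smul]
        · rw [hx j (by simpa using Nat.succ_le_of_lt hj), map_zero, smul_zero]
      · simp
  · intro g
    have h : ∀ x : Fin n → E, (∑ i, u i • (e' ∘ₗ LinearMap.proj i)) x = ∑ i, u i * e' (x i) :=
      fun x => by simp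
    refine Eq.trans ?_ (h _).symm
    rw [show MvPolynomial.eval _ P = _ from hf g]
    simp only [dotProduct, Matrix.mulVec, Representation.matrixTensor_apply, map_sum, map_smul,
      smul_eq_mul, Finset.sum_mul, Finset.mul_sum]
    exact Finset.sum_congr rfl fun i _ => Finset.sum_congr rfl fun j _ => by ring
end
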